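/- Let U ⊂ ℝⁿ be open, N = (0,∞) × U with metric h = dw² + e^{2w} h₀ where h₀ is the Euclidean metric on U. Let T be a covariant tensor of rank k on N with T, ∂_w T ∈ L^p_loc for some p ∈ [1,∞). Then for any x ∈ U with B_r(x) ⊂ U and any 0 ≤ w₀ ≤ w₁, the tangential L^p-norm over the region Ω_{w,x}(r) = {(w',y) : |w'−w| < r, |y−x| < r e^{−w}} satisfies ‖T‖_{L^p_t(Ω_{w₁,x}(r),h)} ≤ ∫_{w₀}^{w₁} e^{(n/p − k)(w₁−w)} ‖∂_w T‖_{L^p_t(Ω_{w,x}(r),h)} dw + e^{(n/p − k)(w₁−w₀)} ‖T‖_{L^p_t(Ω_{w₀,x}(r),h)}. -/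

import Mathlib

open MeasureTheory Set

/-- The cylinder `Ω_{w,x}(r) = {(w',y) : |w'-w| < r, |y-x| < r e^{-w}}` in `(0,∞) × U`. -/
def movingWindow (n : ℕ) (w : ℝ) (x : Fin n → ℝ) (r : ℝ) : Set (ℝ × (Fin n → ℝ)) :=
  {z | |z.1 - w| < r ∧ Real.sqrt (∑ μ, (z.2 μ - x μ) ^ 2) < r * Real.exp (-w)}

/-- Tangential `L^p` norm of a covariant `k`-tensor `T` on `N = (0,∞) × U` with respect to the
metric `h = dw² + e^{2w} h₀`: the tangential pointwise norm is `e^{-kw}` times the Euclidean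
norm of the components, and the measure is `dμ_h = e^{nw} dw dy`. -/
noncomputable def tangentialLpNorm (n k : ℕ) (p : ℝ)
    (T : ℝ × (Fin n → ℝ) → (Fin k → Fin n) → ℝ) (Ω : Set (ℝ × (Fin n → ℝ))) : ℝ :=
  (∫ z in Ω, (Real.exp (-(k : ℝ) * z.1) *
      Real.sqrt (∑ μ : Fin k → Fin n, (T z μ) ^ 2)) ^ p * Real.exp ((n : ℝ) * z.1)) ^ (1 / p)

open scoped ENNReal

/-- A Grönwall-type form of Minkowski's integral inequality: if `f₁ ≤ f₀ + ∫ g_w dw` pointwise and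
`f₁ ∈ L^p`, then `‖f₁‖_p ≤ ‖f₀‖_p + ∫ ‖g_w‖_p dw`. -/
theorem lintegral_rpow_le_add_lintegral_of_le {α β : Type*} [MeasurableSpace α]
    [MeasurableSpace β] {μ : Measure α} {ν : Measure β} [SFinite μ] [SFinite ν] {p : ℝ}
    (hp : 1 ≤ p) {f₁ f₀ : α → ℝ≥0∞} {g : β → α → ℝ≥0∞} (hf₁ : AEMeasurable f₁ μ)
    (hf₀ : AEMeasurable f₀ μ) (hg : AEMeasurable (Function.uncurry g) (ν.prod μ))
    (hle : ∀ a, f₁ a ≤ f₀ a + ∫⁻ w, g w a ∂ν) (hfin : ∫⁻ a, f₁ a ^ p ∂μ ≠ ∞) :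
    (∫⁻ a, f₁ a ^ p ∂μ) ^ (1 / p) ≤
      (∫⁻ a, f₀ a ^ p ∂μ) ^ (1 / p) + ∫⁻ w, (∫⁻ a, g w a ^ p ∂μ) ^ (1 / p) ∂ν := by
  have hp0 : 0 < p := by linarith
  have hgw : ∀ᵐ w ∂ν, AEMeasurable (g w) μ :=
    hg.aestronglyMeasurable.prodMk_left.mono fun w h => h.aemeasurable
  have hga : ∀ᵐ a ∂μ, AEMeasurable (fun w => g w a) ν :=
    hg.prod_swap.aestronglyMeasurable.prodMk_left.mono fun a h => h.aemeasurable
  rcases hp.eq_or_lt with rfl | hp1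
  · simp only [ENNReal.rpow_one, div_one]
    rw [lintegral_lintegral_swap hg, ← lintegral_add_left' hf₀]
    exact lintegral_mono hle
  set A := ∫⁻ a, f₁ a ^ p ∂μ with hA
  rcases eq_or_ne A 0 with hA0 | hA0
  · rw [hA0, ENNReal.zero_rpow_of_pos (by positivity)]
    exact zero_le
  have hpq := Real.HolderConjugate.conjExponent hp1
  set q := p.conjExponent
  have hholder : ∀ f : α → ℝ≥0∞, AEMeasurable f μ →
      ∫⁻ a, f a * f₁ a ^ (p - 1) ∂μ ≤ (∫⁻ a, f a ^ p ∂μ) ^ (1 / p) * A ^ (1 / q) :=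
    fun f hf => ENNReal.lintegral_mul_rpow_le_lintegral_rpow_mul_lintegral_rpow hpq hf hf₁
  have hf₁p : AEMeasurable (fun a => f₁ a ^ (p - 1)) μ := hf₁.pow_const _
  have hswap : AEMeasurable (Function.uncurry fun w a => g w a * f₁ a ^ (p - 1)) (ν.prod μ) :=
    hg.mul hf₁p.comp_snd
  have key : A ≤ ((∫⁻ a, f₀ a ^ p ∂μ) ^ (1 / p) +
      ∫⁻ w, (∫⁻ a, g w a ^ p ∂μ) ^ (1 / p) ∂ν) * A ^ (1 / q) := by
    calc A = ∫⁻ a, f₁ a * f₁ a ^ (p - 1) ∂μ := by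
          refine lintegral_congr fun a => ?_
          have h := ENNReal.rpow_add_of_nonneg (x := f₁ a) 1 (p - 1) zero_le_one (by linarith)
          rw [add_sub_cancel, ENNReal.rpow_one] at h
          exact h
      _ ≤ ∫⁻ a, (f₀ a * f₁ a ^ (p - 1) + ∫⁻ w, g w a * f₁ a ^ (p - 1) ∂ν) ∂μ := by
          refine lintegral_mono_ae ?_
          filter_upwards [hga] with a ha
          rw [lintegral_mul_const'' _ ha, ← add_mul]
          gcongr
          exact hle a
      _ = ∫⁻ a, f₀ a * f₁ a ^ (p - 1) ∂μ + ∫⁻ w, ∫⁻ a, g w a * f₁ a ^ (p - 1) ∂μ ∂ν := by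
          rw [← lintegral_lintegral_swap (f := fun a w => g w a * f₁ a ^ (p - 1)) hswap.prod_swap]
          exact lintegral_add_left' (hf₀.mul hf₁p) _
      _ ≤ (∫⁻ a, f₀ a ^ p ∂μ) ^ (1 / p) * A ^ (1 / q) +
            ∫⁻ w, (∫⁻ a, g w a ^ p ∂μ) ^ (1 / p) * A ^ (1 / q) ∂ν := by
          refine add_le_add (hholder _ hf₀) (lintegral_mono_ae ?_)
          filter_upwards [hgw] with w hw using hholder _ hw
      _ = _ := by
          rw [lintegral_mul_const', add_mul]
          exact ENNReal.rpow_ne_top_of_nonneg (one_div_nonneg.2 hpq.symm.nonneg) hfin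
  have hsplit : A = A ^ (1 / p) * A ^ (1 / q) := by
    rw [← ENNReal.rpow_add _ _ hA0 hfin, one_div, one_div, hpq.inv_add_inv_eq_one,
      ENNReal.rpow_one]
  nth_rewrite 1 [hsplit] at key
  refine (ENNReal.mul_le_mul_iff_left ?_ ?_).1 key
  · simp [ENNReal.rpow_eq_zero_iff, hA0, hfin]
  · exact ENNReal.rpow_ne_top_of_nonneg (one_div_nonneg.2 hpq.symm.nonneg) hfin

theorem enorm_le_enorm_add_lintegral_of_hasDerivAt {E : Type*} [NormedAddCommGroup E]
    [NormedSpace ℝ E] [FiniteDimensional ℝ E] {f f' : ℝ → E}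
    (hf : ∀ t, HasDerivAt f (f' t) t) {a b : ℝ} (hab : a ≤ b) :
    ‖f b‖ₑ ≤ ‖f a‖ₑ + ∫⁻ t in Ioc a b, ‖f' t‖ₑ := by
  have : CompleteSpace E := FiniteDimensional.complete ℝ E
  borelize E
  by_cases hfin : ∫⁻ t in Ioc a b, ‖f' t‖ₑ = ∞
  · simp [hfin]
  have hmeas : AEStronglyMeasurable f' (volume.restrict (Ioc a b)) := by
    have : f' = deriv f := funext fun t => (hf t).deriv.symm
    rw [this]
    exact (stronglyMeasurable_deriv f).aestronglyMeasurable
  have hint : IntegrableOn f' (Ioc a b) := ⟨hmeas, lt_top_iff_ne_top.2 hfin⟩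
  have hftc := intervalIntegral.integral_eq_sub_of_hasDerivAt (fun t _ => hf t)
    ((intervalIntegrable_iff_integrableOn_Ioc_of_le hab).2 hint)
  rw [intervalIntegral.integral_of_le hab] at hftc
  calc ‖f b‖ₑ = ‖f a + ∫ t in Ioc a b, f' t‖ₑ := by rw [hftc, add_sub_cancel]
    _ ≤ ‖f a‖ₑ + ‖∫ t in Ioc a b, f' t‖ₑ := enorm_add_le _ _
    _ ≤ _ := by gcongr; exact enorm_integral_le_lintegral_enorm _

/-- Euclidean length of the components of a covariant `k`-tensor. -/
noncomputable def componentNorm {n k : ℕ} (T : ℝ × (Fin n → ℝ) → (Fin k → Fin n) → ℝ)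
    (z : ℝ × (Fin n → ℝ)) : ℝ :=
  Real.sqrt (∑ μ : Fin k → Fin n, (T z μ) ^ 2)

/-- The density whose `L^p` norm for Lebesgue measure is the tangential `L^p` norm. -/
noncomputable def tangentialDensity (n k : ℕ) (p : ℝ)
    (T : ℝ × (Fin n → ℝ) → (Fin k → Fin n) → ℝ) (z : ℝ × (Fin n → ℝ)) : ℝ≥0∞ :=
  ENNReal.ofReal (Real.exp (((n : ℝ) / p - k) * z.1) * componentNorm T z)

section

variable {n k : ℕ} {p : ℝ} {T T' : ℝ × (Fin n → ℝ) → (Fin k → Fin n) → ℝ}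

theorem componentNorm_nonneg (z : ℝ × (Fin n → ℝ)) : 0 ≤ componentNorm T z :=
  Real.sqrt_nonneg _

theorem ofReal_componentNorm (z : ℝ × (Fin n → ℝ)) :
    ENNReal.ofReal (componentNorm T z) = ‖WithLp.toLp 2 (T z)‖ₑ := by
  rw [← ofReal_norm, EuclideanSpace.norm_eq]
  simp [componentNorm]

theorem componentNorm_le_add_lintegral
    (hderiv : ∀ (w : ℝ) (y : Fin n → ℝ) (μ : Fin k → Fin n),
      HasDerivAt (fun u => T (u, y) μ) (T' (w, y) μ) w)
    {w₀ w₁ : ℝ} (hw : w₀ ≤ w₁) (z : ℝ × (Fin n → ℝ)) :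
    ENNReal.ofReal (componentNorm T ((w₁, 0) + z)) ≤
      ENNReal.ofReal (componentNorm T ((w₀, 0) + z)) +
        ∫⁻ w in Ioc w₀ w₁, ENNReal.ofReal (componentNorm T' ((w, 0) + z)) := by
  obtain ⟨s, y⟩ := z
  simp only [ofReal_componentNorm, Prod.mk_add_mk, zero_add]
  refine enorm_le_enorm_add_lintegral_of_hasDerivAt
    (f := fun w => WithLp.toLp 2 (T (w + s, y))) (fun w => ?_) hw
  have h : HasDerivAt (fun u => T (u + s, y)) (T' (w + s, y)) w :=
    hasDerivAt_pi.2 fun μ => (hderiv (w + s) y μ).comp_add_const w s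
  exact (PiLp.hasFDerivAt_toLp 2 _).comp_hasDerivAt w h

theorem tangentialDensity_rpow (hp : 1 ≤ p) (z : ℝ × (Fin n → ℝ)) :
    tangentialDensity n k p T z ^ p =
      ENNReal.ofReal (Real.exp (((n : ℝ) / p - k) * p * z.1) * componentNorm T z ^ p) := by
  rw [tangentialDensity, ENNReal.ofReal_rpow_of_nonneg
    (mul_nonneg (Real.exp_pos _).le (componentNorm_nonneg z)) (by linarith),
    Real.mul_rpow (Real.exp_pos _).le (componentNorm_nonneg z), ← Real.exp_mul]
  congr 3
  ring

theorem tangentialDensity_shift_le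
    (hderiv : ∀ (w : ℝ) (y : Fin n → ℝ) (μ : Fin k → Fin n),
      HasDerivAt (fun u => T (u, y) μ) (T' (w, y) μ) w)
    {w₀ w₁ : ℝ} (hw : w₀ ≤ w₁) (z : ℝ × (Fin n → ℝ)) :
    tangentialDensity n k p T ((w₁, 0) + z) ≤
      ENNReal.ofReal (Real.exp (((n : ℝ) / p - k) * (w₁ - w₀))) *
          tangentialDensity n k p T ((w₀, 0) + z) +
        ∫⁻ w in Ioc w₀ w₁, ENNReal.ofReal (Real.exp (((n : ℝ) / p - k) * (w₁ - w))) *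
          tangentialDensity n k p T' ((w, 0) + z) := by
  have key : ∀ (S : ℝ × (Fin n → ℝ) → (Fin k → Fin n) → ℝ) (w : ℝ),
      ENNReal.ofReal (Real.exp (((n : ℝ) / p - k) * (w₁ - w))) *
          tangentialDensity n k p S ((w, 0) + z) =
        ENNReal.ofReal (Real.exp (((n : ℝ) / p - k) * (w₁ + z.1))) *
          ENNReal.ofReal (componentNorm S ((w, 0) + z)) := by
    intro S w
    rw [tangentialDensity, ENNReal.ofReal_mul (Real.exp_pos _).le, ← mul_assoc,
      ← ENNReal.ofReal_mul (Real.exp_pos _).le, ← Real.exp_add, Prod.fst_add]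
    congr 3
    ring
  have h₁ := key T w₁
  simp only [sub_self, mul_zero, Real.exp_zero, ENNReal.ofReal_one, one_mul] at h₁
  simp only [key, h₁]
  rw [lintegral_const_mul' _ _ ENNReal.ofReal_ne_top, ← mul_add]
  gcongr
  exact componentNorm_le_add_lintegral hderiv hw z

/-- A compact set containing all moving windows of radius `r` with `w` in a compact interval. -/
theorem exists_isCompact_movingWindow_subset (x : Fin n → ℝ) (r w₀ w₁ : ℝ) :
    ∃ K : Set (ℝ × (Fin n → ℝ)), IsCompact K ∧ ∀ w ∈ Icc w₀ w₁, movingWindow n w x r ⊆ K := by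
  refine ⟨Icc (w₀ - r) (w₁ + r) ×ˢ Metric.closedBall x (|r| * Real.exp (-w₀)),
    isCompact_Icc.prod (isCompact_closedBall _ _), ?_⟩
  rintro w ⟨hw₀, hw₁⟩ ⟨s, y⟩ ⟨h₁, h₂⟩
  rw [abs_lt] at h₁
  refine ⟨⟨by linarith [h₁.1], by linarith [h₁.2]⟩, ?_⟩
  have hb : r * Real.exp (-w) ≤ |r| * Real.exp (-w₀) := by
    gcongr
    exact le_abs_self r
  rw [Metric.mem_closedBall, dist_pi_le_iff (by positivity)]
  intro i
  rw [Real.dist_eq]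
  refine le_trans (Real.abs_le_sqrt ?_) (h₂.le.trans hb)
  exact Finset.single_le_sum (f := fun μ => (y μ - x μ) ^ 2) (fun _ _ => sq_nonneg _)
    (Finset.mem_univ i)

theorem measurableSet_setOf_mem_movingWindow (x : Fin n → ℝ) (r : ℝ) :
    MeasurableSet {q : ℝ × (ℝ × (Fin n → ℝ)) | q.2 ∈ movingWindow n q.1 x r} := by
  refine (IsOpen.inter ?_ ?_).measurableSet
  · exact isOpen_lt (f := fun q : ℝ × (ℝ × (Fin n → ℝ)) => |q.2.1 - q.1|) (by fun_prop)
      continuous_const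
  · exact isOpen_lt
      (f := fun q : ℝ × (ℝ × (Fin n → ℝ)) => Real.sqrt (∑ μ, (q.2.2 μ - x μ) ^ 2))
      (g := fun q => r * Real.exp (-q.1)) (by fun_prop) (by fun_prop)

theorem measurableSet_movingWindow (w : ℝ) (x : Fin n → ℝ) (r : ℝ) :
    MeasurableSet (movingWindow n w x r) :=
  measurable_prodMk_left (measurableSet_setOf_mem_movingWindow x r)

theorem aemeasurable_tangentialDensity (hp : 1 ≤ p)
    (hT : LocallyIntegrable (fun z => componentNorm T z ^ p)) :
    AEMeasurable (tangentialDensity n k p T) := by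
  have h : AEMeasurable (fun z => (componentNorm T z ^ p) ^ (1 / p)) :=
    hT.aestronglyMeasurable.aemeasurable.pow_const _
  have h' : (fun z => (componentNorm T z ^ p) ^ (1 / p)) = componentNorm T := by
    funext z
    rw [← Real.rpow_mul (componentNorm_nonneg z), mul_one_div_cancel (by linarith),
      Real.rpow_one]
  rw [h'] at h
  have hexp : Measurable fun z : ℝ × (Fin n → ℝ) => Real.exp (((n : ℝ) / p - k) * z.1) := by
    fun_prop
  exact (hexp.aemeasurable.mul h).ennreal_ofReal

theorem integrableOn_exp_mul_componentNorm_rpow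
    (hT : LocallyIntegrable (fun z => componentNorm T z ^ p)) (c : ℝ)
    {K : Set (ℝ × (Fin n → ℝ))} (hK : IsCompact K) :
    IntegrableOn (fun z => Real.exp (c * z.1) * componentNorm T z ^ p) K :=
  (hT.integrableOn_isCompact hK).continuousOn_mul (by fun_prop) hK

theorem lintegral_tangentialDensity_rpow_ne_top (hp : 1 ≤ p)
    (hT : LocallyIntegrable (fun z => componentNorm T z ^ p))
    {K : Set (ℝ × (Fin n → ℝ))} (hK : IsCompact K) :
    ∫⁻ z in K, tangentialDensity n k p T z ^ p ≠ ∞ := by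
  simp only [tangentialDensity_rpow hp]
  exact (integrableOn_exp_mul_componentNorm_rpow hT _ hK).lintegral_lt_top.ne

theorem tangentialLpNorm_nonneg (Ω : Set (ℝ × (Fin n → ℝ))) :
    0 ≤ tangentialLpNorm n k p T Ω :=
  Real.rpow_nonneg (integral_nonneg fun _ => by positivity) _

theorem ofReal_tangentialLpNorm (hp : 1 ≤ p)
    (hT : LocallyIntegrable (fun z => componentNorm T z ^ p))
    {Ω K : Set (ℝ × (Fin n → ℝ))} (hK : IsCompact K) (hΩ : Ω ⊆ K) :
    ENNReal.ofReal (tangentialLpNorm n k p T Ω) =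
      (∫⁻ z in Ω, tangentialDensity n k p T z ^ p) ^ (1 / p) := by
  have hp0 : p ≠ 0 := by linarith
  have heq : ∀ z : ℝ × (Fin n → ℝ), (Real.exp (-(k : ℝ) * z.1) *
      Real.sqrt (∑ μ : Fin k → Fin n, (T z μ) ^ 2)) ^ p * Real.exp ((n : ℝ) * z.1) =
      Real.exp (((n : ℝ) / p - k) * p * z.1) * componentNorm T z ^ p := by
    intro z
    rw [Real.mul_rpow (Real.exp_pos _).le (Real.sqrt_nonneg _), ← Real.exp_mul,
      mul_right_comm, ← Real.exp_add, componentNorm]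
    congr 2
    field_simp
    ring
  rw [tangentialLpNorm]
  simp only [heq]
  rw [← ENNReal.ofReal_rpow_of_nonneg _ (by positivity), ofReal_integral_eq_lintegral_ofReal]
  · simp only [tangentialDensity_rpow hp]
  · exact (integrableOn_exp_mul_componentNorm_rpow hT _ hK).mono_set hΩ
  · exact .of_forall fun z => mul_nonneg (Real.exp_pos _).le
      (Real.rpow_nonneg (componentNorm_nonneg z) _)
  · exact integral_nonneg fun z => mul_nonneg (Real.exp_pos _).le
      (Real.rpow_nonneg (componentNorm_nonneg z) _)

theorem measurePreserving_shift (w : ℝ) :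
    MeasurePreserving (fun z : ℝ × (Fin n → ℝ) => (w, 0) + z) := by
  have : (volume : Measure (ℝ × (Fin n → ℝ))).IsAddLeftInvariant :=
    inferInstanceAs ((volume : Measure ℝ).prod (volume : Measure (Fin n → ℝ))).IsAddLeftInvariant
  exact measurePreserving_add_left volume _

theorem setLIntegral_comp_shift (f : ℝ × (Fin n → ℝ) → ℝ≥0∞) (w : ℝ)
    (s : Set (ℝ × (Fin n → ℝ))) :
    ∫⁻ z in ((w, 0) + ·) ⁻¹' s, f ((w, 0) + z) = ∫⁻ z in s, f z :=
  (measurePreserving_shift w).setLIntegral_comp_preimage_emb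
    (measurableEmbedding_addLeft _) f s

theorem quasiMeasurePreserving_shift :
    Measure.QuasiMeasurePreserving
      (fun q : ℝ × (ℝ × (Fin n → ℝ)) => (q.1, (0 : Fin n → ℝ)) + q.2)
      ((volume : Measure ℝ).prod volume) volume := by
  have h := MeasurePreserving.skew_product (μa := (volume : Measure ℝ))
    (μb := (volume : Measure ℝ)) (μc := (volume : Measure (ℝ × (Fin n → ℝ))))
    (μd := (volume : Measure (ℝ × (Fin n → ℝ)))) (MeasurePreserving.id _)
    (g := fun w z => (w, (0 : Fin n → ℝ)) + z) (by fun_prop)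
    (.of_forall fun w => (measurePreserving_shift w).map_eq)
  exact Measure.quasiMeasurePreserving_snd.comp h.quasiMeasurePreserving

theorem preimage_shift_movingWindow_subset {w w₁ : ℝ} (hw : w ≤ w₁) (x : Fin n → ℝ) {r : ℝ}
    (hr : 0 < r) :
    ((w₁, 0) + ·) ⁻¹' movingWindow n w₁ x r ⊆ ((w, 0) + ·) ⁻¹' movingWindow n w x r := by
  rintro ⟨s, y⟩ ⟨h₁, h₂⟩
  simp only [Prod.mk_add_mk, zero_add, add_sub_cancel_left] at h₁ h₂
  refine ⟨by simpa using h₁, ?_⟩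
  simp only [Prod.mk_add_mk, zero_add]
  refine h₂.trans_le ?_
  gcongr

theorem lintegral_tangentialDensity_movingWindow_le (hp : 1 ≤ p)
    (x : Fin n → ℝ) {r : ℝ} (hr : 0 < r)
    (hderiv : ∀ (w : ℝ) (y : Fin n → ℝ) (μ : Fin k → Fin n),
      HasDerivAt (fun u => T (u, y) μ) (T' (w, y) μ) w)
    (hT : LocallyIntegrable (fun z => componentNorm T z ^ p))
    (hT' : LocallyIntegrable (fun z => componentNorm T' z ^ p))
    {w₀ w₁ : ℝ} (hw : w₀ ≤ w₁) :
    (∫⁻ z in movingWindow n w₁ x r, tangentialDensity n k p T z ^ p) ^ (1 / p) ≤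
      ENNReal.ofReal (Real.exp (((n : ℝ) / p - k) * (w₁ - w₀))) *
        (∫⁻ z in movingWindow n w₀ x r, tangentialDensity n k p T z ^ p) ^ (1 / p) +
      ∫⁻ w in Ioc w₀ w₁, ENNReal.ofReal (Real.exp (((n : ℝ) / p - k) * (w₁ - w))) *
        (∫⁻ z in movingWindow n w x r, tangentialDensity n k p T' z ^ p) ^ (1 / p) := by
  have hp0 : 0 < p := by linarith
  have hTm := aemeasurable_tangentialDensity hp hT
  have hTm' := aemeasurable_tangentialDensity hp hT'
  set D : Set (ℝ × (Fin n → ℝ)) := ((w₁, 0) + ·) ⁻¹' movingWindow n w₁ x r with hD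
  have hshift : ∀ w : ℝ, AEMeasurable
      (fun z => tangentialDensity n k p T ((w, 0) + z)) (volume.restrict D) := fun w =>
    (hTm.comp_quasiMeasurePreserving (measurePreserving_shift w).quasiMeasurePreserving).restrict
  have hscale : ∀ (S : ℝ × (Fin n → ℝ) → (Fin k → Fin n) → ℝ) (w : ℝ), w ≤ w₁ →
      (∫⁻ z in D, (ENNReal.ofReal (Real.exp (((n : ℝ) / p - k) * (w₁ - w))) *
        tangentialDensity n k p S ((w, 0) + z)) ^ p) ^ (1 / p) ≤
      ENNReal.ofReal (Real.exp (((n : ℝ) / p - k) * (w₁ - w))) *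
        (∫⁻ z in movingWindow n w x r, tangentialDensity n k p S z ^ p) ^ (1 / p) := by
    intro S w hww
    simp only [ENNReal.mul_rpow_of_nonneg _ _ hp0.le]
    rw [lintegral_const_mul' _ _ (ENNReal.rpow_ne_top_of_nonneg hp0.le ENNReal.ofReal_ne_top),
      ENNReal.mul_rpow_of_nonneg _ _ (by positivity), ← ENNReal.rpow_mul,
      mul_one_div_cancel hp0.ne', ENNReal.rpow_one,
      ← setLIntegral_comp_shift (fun z => tangentialDensity n k p S z ^ p) w]
    gcongr
    exact preimage_shift_movingWindow_subset hww x hr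
  obtain ⟨K, hK, hsub⟩ := exists_isCompact_movingWindow_subset x r w₁ w₁
  have hfin : ∫⁻ z in D, tangentialDensity n k p T ((w₁, 0) + z) ^ p ≠ ∞ := by
    rw [hD, setLIntegral_comp_shift (fun z => tangentialDensity n k p T z ^ p) w₁]
    exact ne_top_of_le_ne_top (lintegral_tangentialDensity_rpow_ne_top hp hT hK)
      (lintegral_mono_set (hsub w₁ ⟨le_rfl, le_rfl⟩))
  have hjoint : AEMeasurable (Function.uncurry fun (w : ℝ) (z : ℝ × (Fin n → ℝ)) =>
      ENNReal.ofReal (Real.exp (((n : ℝ) / p - k) * (w₁ - w))) *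
        tangentialDensity n k p T' ((w, 0) + z))
      ((volume.restrict (Ioc w₀ w₁)).prod (volume.restrict D)) := by
    rw [Measure.prod_restrict]
    have hexp : Measurable fun q : ℝ × (ℝ × (Fin n → ℝ)) =>
        ENNReal.ofReal (Real.exp (((n : ℝ) / p - k) * (w₁ - q.1))) := by fun_prop
    exact (hexp.aemeasurable.mul
      (hTm'.comp_quasiMeasurePreserving quasiMeasurePreserving_shift)).restrict
  calc (∫⁻ z in movingWindow n w₁ x r, tangentialDensity n k p T z ^ p) ^ (1 / p)
      = (∫⁻ z in D, tangentialDensity n k p T ((w₁, 0) + z) ^ p) ^ (1 / p) := by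
        rw [hD, setLIntegral_comp_shift (fun z => tangentialDensity n k p T z ^ p) w₁]
    _ ≤ _ := lintegral_rpow_le_add_lintegral_of_le hp (hshift w₁) ((hshift w₀).const_mul _)
        hjoint (tangentialDensity_shift_le hderiv hw) hfin
    _ ≤ _ := add_le_add (hscale T w₀ hw)
        (setLIntegral_mono' measurableSet_Ioc fun w hw' => hscale T' w hw'.2)

theorem aemeasurable_lintegral_movingWindow (hp : 1 ≤ p)
    (hT : LocallyIntegrable (fun z => componentNorm T z ^ p)) (x : Fin n → ℝ) (r : ℝ) :
    AEMeasurable (fun w => ∫⁻ z in movingWindow n w x r, tangentialDensity n k p T z ^ p) := by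
  have hind : ∀ w, ∫⁻ z in movingWindow n w x r, tangentialDensity n k p T z ^ p =
      ∫⁻ z, {q : ℝ × (ℝ × (Fin n → ℝ)) | q.2 ∈ movingWindow n q.1 x r}.indicator
        (fun q => tangentialDensity n k p T q.2 ^ p) (w, z) := fun w => by
    rw [← lintegral_indicator (measurableSet_movingWindow w x r)]
    rfl
  simp only [hind]
  refine AEMeasurable.lintegral_prod_right' (AEMeasurable.indicator ?_
    (measurableSet_setOf_mem_movingWindow x r))
  exact ((aemeasurable_tangentialDensity hp hT).pow_const p).comp_snd

theorem integrableOn_exp_mul_tangentialLpNorm_movingWindow (hp : 1 ≤ p)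
    (hT : LocallyIntegrable (fun z => componentNorm T z ^ p)) (x : Fin n → ℝ) (r w₀ w₁ : ℝ) :
    IntegrableOn (fun w => Real.exp (((n : ℝ) / p - k) * (w₁ - w)) *
      tangentialLpNorm n k p T (movingWindow n w x r)) (Icc w₀ w₁) := by
  have hp0 : 0 < p := by linarith
  obtain ⟨K, hK, hsub⟩ := exists_isCompact_movingWindow_subset x r w₀ w₁
  have hnorm : ∀ w ∈ Icc w₀ w₁, ENNReal.ofReal (tangentialLpNorm n k p T (movingWindow n w x r)) =
      (∫⁻ z in movingWindow n w x r, tangentialDensity n k p T z ^ p) ^ (1 / p) :=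
    fun w hw => ofReal_tangentialLpNorm hp hT hK (hsub w hw)
  have hmeas : AEMeasurable (fun w => tangentialLpNorm n k p T (movingWindow n w x r))
      (volume.restrict (Icc w₀ w₁)) := by
    refine (((aemeasurable_lintegral_movingWindow hp hT x r).pow_const
      (1 / p)).restrict.ennreal_toReal).congr ?_
    filter_upwards [ae_restrict_mem measurableSet_Icc] with w hw
    rw [← hnorm w hw, ENNReal.toReal_ofReal (tangentialLpNorm_nonneg _)]
  refine IntegrableOn.continuousOn_mul (by fun_prop) ?_ isCompact_Icc
  refine Integrable.of_bound hmeas.aestronglyMeasurable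
    ((∫⁻ z in K, tangentialDensity n k p T z ^ p) ^ (1 / p)).toReal ?_
  filter_upwards [ae_restrict_mem measurableSet_Icc] with w hw
  rw [Real.norm_of_nonneg (tangentialLpNorm_nonneg _), ← ENNReal.ofReal_le_iff_le_toReal
    (ENNReal.rpow_ne_top_of_nonneg (by positivity)
      (lintegral_tangentialDensity_rpow_ne_top hp hT hK)), hnorm w hw]
  gcongr
  exact hsub w hw

end

/-- **First integration lemma (moving window).** For a covariant `k`-tensor `T` on
`N = (0,∞) × U` with `T, ∂_w T ∈ L^p_loc`, and `0 ≤ w₀ ≤ w₁`,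
`‖T‖_{L^p_t(Ω_{w₁,x}(r))} ≤ ∫_{w₀}^{w₁} e^{(n/p - k)(w₁-w)} ‖∂_w T‖_{L^p_t(Ω_{w,x}(r))} dw
  + e^{(n/p - k)(w₁-w₀)} ‖T‖_{L^p_t(Ω_{w₀,x}(r))}`. -/
theorem moving_window_estimate (n k : ℕ) (p : ℝ) (hp1 : 1 ≤ p)
    (U : Set (Fin n → ℝ)) (hU : IsOpen U) (x : Fin n → ℝ) (r : ℝ) (hr : 0 < r)
    (hball : {y : Fin n → ℝ | Real.sqrt (∑ μ, (y μ - x μ) ^ 2) < r} ⊆ U)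
    (T T0 : ℝ × (Fin n → ℝ) → (Fin k → Fin n) → ℝ)
    (hderiv : ∀ (w : ℝ) (y : Fin n → ℝ) (μ : Fin k → Fin n),
      HasDerivAt (fun u => T (u, y) μ) (T0 (w, y) μ) w)
    (hTloc : LocallyIntegrable
      (fun z => (Real.sqrt (∑ μ : Fin k → Fin n, (T z μ) ^ 2)) ^ p) volume)
    (hT0loc : LocallyIntegrable
      (fun z => (Real.sqrt (∑ μ : Fin k → Fin n, (T0 z μ) ^ 2)) ^ p) volume)
    (w₀ w₁ : ℝ) (hw₀ : 0 ≤ w₀) (hw : w₀ ≤ w₁) :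
    tangentialLpNorm n k p T (movingWindow n w₁ x r) ≤
      (∫ w in w₀..w₁, Real.exp (((n : ℝ) / p - k) * (w₁ - w)) *
        tangentialLpNorm n k p T0 (movingWindow n w x r)) +
      Real.exp (((n : ℝ) / p - k) * (w₁ - w₀)) *
        tangentialLpNorm n k p T (movingWindow n w₀ x r) := by
  have hT : LocallyIntegrable (fun z => componentNorm T z ^ p) := hTloc
  have hT0 : LocallyIntegrable (fun z => componentNorm T0 z ^ p) := hT0loc
  obtain ⟨K, hK, hsub⟩ := exists_isCompact_movingWindow_subset x r w₀ w₁
  have hnonneg : ∀ w, 0 ≤ Real.exp (((n : ℝ) / p - k) * (w₁ - w)) *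
      tangentialLpNorm n k p T0 (movingWindow n w x r) := fun w =>
    mul_nonneg (Real.exp_pos _).le (tangentialLpNorm_nonneg _)
  have hlast : 0 ≤ Real.exp (((n : ℝ) / p - k) * (w₁ - w₀)) *
      tangentialLpNorm n k p T (movingWindow n w₀ x r) :=
    mul_nonneg (Real.exp_pos _).le (tangentialLpNorm_nonneg _)
  have hint := intervalIntegral.integral_nonneg (μ := volume) hw fun w _ => hnonneg w
  rw [← ENNReal.ofReal_le_ofReal_iff (add_nonneg hint hlast), ENNReal.ofReal_add hint hlast,
    ENNReal.ofReal_mul (Real.exp_pos _).le,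
    ofReal_tangentialLpNorm hp1 hT hK (hsub w₁ ⟨hw, le_rfl⟩),
    ofReal_tangentialLpNorm hp1 hT hK (hsub w₀ ⟨le_rfl, hw⟩),
    intervalIntegral.integral_of_le hw, ofReal_integral_eq_lintegral_ofReal
      ((integrableOn_exp_mul_tangentialLpNorm_movingWindow hp1 hT0 x r w₀ w₁).mono_set
        Ioc_subset_Icc_self) (.of_forall hnonneg), add_comm]
  refine (lintegral_tangentialDensity_movingWindow_le hp1 x hr hderiv hT hT0 hw).trans_eq ?_
  congr 1
  refine setLIntegral_congr_fun measurableSet_Ioc fun w hw' => ?_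
  rw [ENNReal.ofReal_mul (Real.exp_pos _).le,
    ofReal_tangentialLpNorm hp1 hT0 hK (hsub w (Ioc_subset_Icc_self hw'))]
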